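/- arXiv:2506.21437 — 7 statements merged into one kernel-verified Lean document; each statement's English description precedes it below -/
import Mathlib

section
/- Let α ∈ [0,1), γ > 0 and M > 0. There exists β₀ > 0 such that for every β ∈ [0, β₀] there are constants C > 0 and ω > 0 with the following property: for every y₀ ≥ 0 and every continuous function y : [0,∞) → [0,∞) satisfying y(t) ≤ M·e^{−γt}·y₀ + β·M·∫₀ᵗ (t−s)^{−α} e^{−γ(t−s)} y(s) ds for all t ≥ 0, one has y(t) ≤ C·y₀·e^{−ωt} for all t ≥ 0. -/
open MeasureTheory Set in
/-- Convolving the kernel `k u * exp (-c * u)`, with `k` nonnegative and integrable, preserves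
exponential decay: if `0 ≤ y s ≤ K * exp (-c * s)` on `[0, t]`, then the convolution at `t` is at most
`K * exp (-c * t)` times the integral of `k`. -/
theorem intervalIntegral_conv_le_of_le_exp {k y : ℝ → ℝ} {c K t : ℝ} (ht : 0 ≤ t) (hK : 0 ≤ K)
    (hk : IntegrableOn k (Ioi 0)) (hk0 : ∀ u, 0 ≤ u → 0 ≤ k u)
    (hy0 : ∀ s ∈ Icc 0 t, 0 ≤ y s) (hy : ∀ s ∈ Icc 0 t, y s ≤ K * Real.exp (-c * s)) :
    ∫ s in (0:ℝ)..t, k (t - s) * Real.exp (-c * (t - s)) * y s ≤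
      K * Real.exp (-c * t) * ∫ u in Ioi 0, k u := by
  have hki : IntervalIntegrable k volume 0 t :=
    (intervalIntegrable_iff_integrableOn_Ioc_of_le ht).2 (hk.mono_set Ioc_subset_Ioi_self)
  have hki' : IntervalIntegrable (fun s => k (t - s)) volume 0 t := by
    simpa using (hki.comp_sub_left t).symm
  have hint : IntegrableOn (fun s => K * Real.exp (-c * t) * k (t - s)) (Ioc 0 t) :=
    (intervalIntegrable_iff_integrableOn_Ioc_of_le ht).1 (hki'.const_mul _)
  calc ∫ s in (0:ℝ)..t, k (t - s) * Real.exp (-c * (t - s)) * y s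
      ≤ ∫ s in (0:ℝ)..t, K * Real.exp (-c * t) * k (t - s) := by
        rw [intervalIntegral.integral_of_le ht, intervalIntegral.integral_of_le ht]
        refine integral_mono_of_nonneg ?_ hint ?_
        · filter_upwards [ae_restrict_mem measurableSet_Ioc] with s hs
          exact mul_nonneg (mul_nonneg (hk0 _ (sub_nonneg.2 hs.2)) (Real.exp_pos _).le)
            (hy0 s ⟨hs.1.le, hs.2⟩)
        · filter_upwards [ae_restrict_mem measurableSet_Ioc] with s hs
          have hexp : Real.exp (-c * t) = Real.exp (-c * (t - s)) * Real.exp (-c * s) := by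
            rw [← Real.exp_add]; ring_nf
          calc k (t - s) * Real.exp (-c * (t - s)) * y s
              ≤ k (t - s) * Real.exp (-c * (t - s)) * (K * Real.exp (-c * s)) :=
                mul_le_mul_of_nonneg_left (hy s ⟨hs.1.le, hs.2⟩)
                  (mul_nonneg (hk0 _ (sub_nonneg.2 hs.2)) (Real.exp_pos _).le)
            _ = K * Real.exp (-c * t) * k (t - s) := by rw [hexp]; ring
    _ = K * Real.exp (-c * t) * ∫ u in (0:ℝ)..t, k u := by
        rw [intervalIntegral.integral_const_mul, intervalIntegral.integral_comp_sub_left]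
        simp
    _ ≤ K * Real.exp (-c * t) * ∫ u in Ioi 0, k u := by
        rw [intervalIntegral.integral_of_le ht]
        refine mul_le_mul_of_nonneg_left
          (setIntegral_mono_set hk ?_ Ioc_subset_Ioi_self.eventuallyLE) (by positivity)
        filter_upwards [ae_restrict_mem measurableSet_Ioi] with u hu
        exact hk0 u (mem_Ioi.1 hu).le

/-- Grönwall-type lemma with a weakly singular kernel `(t-s)^(-α)`, `α ∈ [0,1)`:
the key quantitative step in the proof of Theorem 3.1 of the paper. -/
theorem gronwall_singular_kernel
    (α γ M : ℝ) (hα0 : 0 ≤ α) (hα1 : α < 1) (hγ : 0 < γ) (hM : 0 < M) :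
    ∃ β₀ > 0, ∀ β : ℝ, 0 ≤ β → β ≤ β₀ →
      ∃ C > 0, ∃ ω > 0,
        ∀ y₀ : ℝ, 0 ≤ y₀ → ∀ y : ℝ → ℝ,
          ContinuousOn y (Set.Ici 0) →
          (∀ t, 0 ≤ t → 0 ≤ y t) →
          (∀ t, 0 ≤ t → y t ≤ M * Real.exp (-γ * t) * y₀ +
            β * M * ∫ s in (0:ℝ)..t, (t - s) ^ (-α) * Real.exp (-γ * (t - s)) * y s) →
          ∀ t, 0 ≤ t → y t ≤ C * y₀ * Real.exp (-ω * t) := by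
  set c := γ / 2 with hc
  have hcpos : 0 < c := by positivity
  let k : ℝ → ℝ := fun u => u ^ (-α) * Real.exp (-c * u)
  have hk : MeasureTheory.IntegrableOn k (Set.Ioi 0) := by
    simpa [k] using integrableOn_rpow_mul_exp_neg_mul_rpow (s := -α) (by linarith) zero_lt_one hcpos
  have hk0 : ∀ u, 0 ≤ u → 0 ≤ k u := fun u hu => by positivity
  set I := ∫ u in Set.Ioi 0, k u
  have hI0 : 0 ≤ I := MeasureTheory.setIntegral_nonneg measurableSet_Ioi
    fun u hu => hk0 u (Set.mem_Ioi.1 hu).le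
  refine ⟨1 / (2 * M * (I + 1)), by positivity, fun β hβ0 hβ => ⟨2 * M, by positivity, c, hcpos, ?_⟩⟩
  intro y₀ hy₀ y hyc hy0 hy t ht
  have hβI : β * M * I ≤ 1 / 2 := by
    rw [le_div_iff₀ (by positivity)] at hβ
    nlinarith [mul_nonneg hβ0 hM.le]
  obtain ⟨τ, hτ, hmax⟩ := isCompact_Icc.exists_isMaxOn (Set.nonempty_Icc.2 ht)
    (f := fun s => y s * Real.exp (c * s))
    ((hyc.mono Set.Icc_subset_Ici_self).mul (by fun_prop))
  set K := y τ * Real.exp (c * τ)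
  have hK : 0 ≤ K := mul_nonneg (hy0 τ hτ.1) (Real.exp_pos _).le
  have hyK : ∀ s ∈ Set.Icc 0 t, y s ≤ K * Real.exp (-c * s) := fun s hs => by
    have h : y s * Real.exp (c * s) ≤ K := hmax hs
    rwa [neg_mul, Real.exp_neg, ← div_eq_mul_inv, le_div_iff₀ (Real.exp_pos _)]
  have hconv := intervalIntegral_conv_le_of_le_exp (c := c) hτ.1 hK hk hk0
    (fun s hs => hy0 s hs.1) (fun s hs => hyK s ⟨hs.1, hs.2.trans hτ.2⟩)
  have hker : ∀ s, k (τ - s) * Real.exp (-c * (τ - s)) * y s =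
      (τ - s) ^ (-α) * Real.exp (-γ * (τ - s)) * y s := fun s => by
    simp only [k]
    rw [mul_assoc (_ ^ _), ← Real.exp_add]
    congr 3
    rw [hc]; ring
  simp only [hker] at hconv
  have hK_le : K ≤ 2 * M * y₀ := by
    have hdecay : Real.exp (-γ * τ) ≤ Real.exp (-c * τ) :=
      Real.exp_le_exp.2 (by nlinarith [hτ.1])
    have hyτ : y τ ≤ (M * y₀ + β * M * I * K) * Real.exp (-c * τ) := by
      calc y τ ≤ _ := hy τ hτ.1
        _ ≤ M * Real.exp (-c * τ) * y₀ + β * M * (K * Real.exp (-c * τ) * I) := by gcongr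
        _ = _ := by ring
    have hKτ : K ≤ M * y₀ + β * M * I * K := by
      rwa [neg_mul, Real.exp_neg, ← div_eq_mul_inv, le_div_iff₀ (Real.exp_pos _)] at hyτ
    nlinarith [mul_le_mul_of_nonneg_right hβI hK]
  calc y t ≤ K * Real.exp (-c * t) := hyK t ⟨ht, le_rfl⟩
    _ ≤ 2 * M * y₀ * Real.exp (-c * t) := by gcongr
end

section
/- Let α ∈ [0,1), γ > 0, ω > 0, M ≥ 1, β ≥ 0, ρ ≥ 0 and T > 0, and set C_γ := ∫₀^∞ e^{−γu} u^{−α} du. Let y, z : [0,T] → [0,∞) be continuous functions satisfying, for all t ∈ [0,T], y(t) ≤ M·e^{−γt}·y(0) + M·β·∫₀ᵗ e^{−γ(t−s)} (t−s)^{−α} (y(s)+z(s)) ds and z(t) ≤ M·ρ·e^{−ω(T−t)} + M·β·∫ₜ^T e^{−ω(s−t)} (y(s)+z(s)) ds. If M·β·(C_γ + 1/ω) ≤ 1/2, then ∫₀^T (y(s)+z(s)) ds ≤ (2M/γ)·y(0) + (2M/ω)·ρ. -/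
open MeasureTheory Set

lemma intervalIntegral_le_of_le_add_mul_convolution {T K : ℝ} (hT : 0 ≤ T) (hK : 0 ≤ K)
    {w b g k : ℝ → ℝ} (hw : ContinuousOn w (Icc 0 T)) (hb : ContinuousOn b (Icc 0 T))
    (hg : Integrable g) (hk : Integrable k) (hg0 : 0 ≤ g) (hk0 : 0 ≤ k)
    (hle : ∀ t ∈ Icc (0 : ℝ) T, w t ≤ b t + K * ∫ s, g s * k (t - s)) :
    ∫ t in (0 : ℝ)..T, w t ≤ (∫ t in (0 : ℝ)..T, b t) + K * ((∫ t, g t) * ∫ t, k t) := by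
  have hconv : Integrable (fun t ↦ ∫ s, g s * k (t - s)) :=
    hg.integrable_convolution (ContinuousLinearMap.mul ℝ ℝ) hk
  have hint : ∫ t, ∫ s, g s * k (t - s) = (∫ t, g t) * ∫ t, k t :=
    integral_convolution (ContinuousLinearMap.mul ℝ ℝ) hg hk
  have hwi : IntervalIntegrable w volume 0 T := hw.intervalIntegrable_of_Icc hT
  have hbi : IntervalIntegrable b volume 0 T := hb.intervalIntegrable_of_Icc hT
  have hci : IntervalIntegrable (fun t ↦ K * ∫ s, g s * k (t - s)) volume 0 T :=
    (hconv.const_mul K).intervalIntegrable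
  calc ∫ t in (0 : ℝ)..T, w t
      ≤ ∫ t in (0 : ℝ)..T, (b t + K * ∫ s, g s * k (t - s)) :=
        intervalIntegral.integral_mono_on hT hwi (hbi.add hci) hle
    _ = (∫ t in (0 : ℝ)..T, b t) + K * ∫ t in (0 : ℝ)..T, ∫ s, g s * k (t - s) := by
        rw [intervalIntegral.integral_add hbi hci, intervalIntegral.integral_const_mul]
    _ ≤ (∫ t in (0 : ℝ)..T, b t) + K * ((∫ t, g t) * ∫ t, k t) := by
        rw [← hint]
        gcongr
        rw [intervalIntegral.integral_of_le hT]
        exact setIntegral_le_integral hconv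
          (ae_of_all _ fun t ↦ integral_nonneg fun s ↦ mul_nonneg (hg0 s) (hk0 _))

lemma integral_indicator_Ioc_mul_indicator_Ici {T t : ℝ} (ht : t ∈ Icc (0 : ℝ) T) (f k : ℝ → ℝ) :
    ∫ s, (Ioc 0 T).indicator f s * (Ici 0).indicator k (t - s)
      = ∫ s in (0 : ℝ)..t, k (t - s) * f s := by
  rw [intervalIntegral.integral_of_le ht.1, ← integral_indicator measurableSet_Ioc]
  congr 1 with s
  have := ht.2
  simp only [indicator, mem_Ioc, mem_Ici, sub_nonneg]
  split_ifs <;> grind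

lemma integral_indicator_Ioc_mul_indicator_Iio {T t : ℝ} (ht : t ∈ Icc (0 : ℝ) T) (f k : ℝ → ℝ) :
    ∫ s, (Ioc 0 T).indicator f s * (Iio 0).indicator k (t - s)
      = ∫ s in t..T, k (t - s) * f s := by
  rw [intervalIntegral.integral_of_le ht.2, ← integral_indicator measurableSet_Ioc]
  congr 1 with s
  have := ht.1
  simp only [indicator, mem_Ioc, mem_Iio, sub_neg]
  split_ifs <;> grind

lemma intervalIntegral_exp_neg_mul_le {c : ℝ} (hc : 0 < c) {T : ℝ} (hT : 0 ≤ T) :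
    ∫ t in (0 : ℝ)..T, Real.exp (-c * t) ≤ 1 / c := by
  rw [intervalIntegral.integral_of_le hT]
  calc ∫ t in Ioc 0 T, Real.exp (-c * t)
      ≤ ∫ t in Ioi 0, Real.exp (-c * t) :=
        setIntegral_mono_set (integrableOn_exp_mul_Ioi (neg_lt_zero.2 hc) 0)
          (ae_of_all _ fun _ ↦ (Real.exp_pos _).le) Ioc_subset_Ioi_self.eventuallyLE
    _ = 1 / c := by
        rw [integral_exp_mul_Ioi (neg_lt_zero.2 hc)]
        simp

lemma integrableOn_exp_neg_mul_mul_rpow {α γ : ℝ} (hα : α < 1) (hγ : 0 < γ) :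
    IntegrableOn (fun u : ℝ ↦ Real.exp (-γ * u) * u ^ (-α)) (Ioi 0) := by
  simpa [mul_comm] using
    integrableOn_rpow_mul_exp_neg_mul_rpow (p := 1) (s := -α) (by linarith) one_pos hγ


/-- Forward–backward pair of scalar integral inequalities and the resulting L¹ bound
(estimates (2.65)–(eq:estimate-int-t1-y-z) in the proof of Theorem 3.2 of the paper). -/
theorem forward_backward_L1_bound
    (α γ ω M β ρ T : ℝ) (hα0 : 0 ≤ α) (hα1 : α < 1) (hγ : 0 < γ)
    (hω : 0 < ω) (hM : 1 ≤ M) (hβ : 0 ≤ β) (hρ : 0 ≤ ρ) (hT : 0 < T)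
    (Cγ : ℝ) (hCγ : Cγ = ∫ u in Set.Ioi (0:ℝ), Real.exp (-γ * u) * u ^ (-α))
    (y z : ℝ → ℝ)
    (hy : ContinuousOn y (Set.Icc 0 T)) (hz : ContinuousOn z (Set.Icc 0 T))
    (hy0 : ∀ t ∈ Set.Icc (0:ℝ) T, 0 ≤ y t)
    (hz0 : ∀ t ∈ Set.Icc (0:ℝ) T, 0 ≤ z t)
    (hyineq : ∀ t ∈ Set.Icc (0:ℝ) T,
      y t ≤ M * Real.exp (-γ * t) * y 0 +
        M * β * ∫ s in (0:ℝ)..t, Real.exp (-γ * (t - s)) * (t - s) ^ (-α) * (y s + z s))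
    (hzineq : ∀ t ∈ Set.Icc (0:ℝ) T,
      z t ≤ M * ρ * Real.exp (-ω * (T - t)) +
        M * β * ∫ s in t..T, Real.exp (-ω * (s - t)) * (y s + z s))
    (hsmall : M * β * (Cγ + 1 / ω) ≤ 1 / 2) :
    (∫ s in (0:ℝ)..T, (y s + z s)) ≤ 2 * M / γ * y 0 + 2 * M / ω * ρ := by
  set f : ℝ → ℝ := fun s ↦ y s + z s with hf
  set g := (Ioc 0 T).indicator f with hg
  have hfc : ContinuousOn f (Icc 0 T) := hy.add hz
  have hgi : Integrable g :=
    (integrable_indicator_iff measurableSet_Ioc).2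
      (hfc.integrableOn_Icc.mono_set Ioc_subset_Icc_self)
  have hg0 : 0 ≤ g := indicator_nonneg fun s hs ↦
    add_nonneg (hy0 s (Ioc_subset_Icc_self hs)) (hz0 s (Ioc_subset_Icc_self hs))
  have hgint : ∫ s, g s = ∫ s in (0 : ℝ)..T, f s := by
    rw [intervalIntegral.integral_of_le hT.le, hg, integral_indicator measurableSet_Ioc]
  have hMβ : 0 ≤ M * β := mul_nonneg (by linarith) hβ
  have hybound : ∫ t in (0 : ℝ)..T, y t ≤ M * y 0 / γ + M * β * ((∫ s, g s) * Cγ) := by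
    set k : ℝ → ℝ := (Ici 0).indicator fun u ↦ Real.exp (-γ * u) * u ^ (-α) with hk
    have hki : Integrable k := (integrable_indicator_iff measurableSet_Ici).2
      (integrableOn_Ici_iff_integrableOn_Ioi (by simp) |>.2 <|
      integrableOn_exp_neg_mul_mul_rpow hα1 hγ)
    have hk0 : 0 ≤ k := indicator_nonneg fun u hu ↦
      mul_nonneg (Real.exp_pos _).le (Real.rpow_nonneg hu _)
    have hkint : ∫ u, k u = Cγ := by
      rw [hCγ, hk, integral_indicator measurableSet_Ici, integral_Ici_eq_integral_Ioi]
    have h := intervalIntegral_le_of_le_add_mul_convolution hT.le hMβ hy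
      (b := fun t ↦ M * y 0 * Real.exp (-γ * t)) (by fun_prop) hgi hki hg0 hk0 fun t ht ↦ by
        rw [integral_indicator_Ioc_mul_indicator_Ici ht]
        exact (hyineq t ht).trans_eq (by ring)
    rw [intervalIntegral.integral_const_mul, hkint] at h
    have hy00 := hy0 0 ⟨le_rfl, hT.le⟩
    have := mul_le_mul_of_nonneg_left (intervalIntegral_exp_neg_mul_le hγ hT.le)
      (mul_nonneg (by linarith : 0 ≤ M) hy00)
    rw [mul_one_div] at this
    linarith
  have hzbound : ∫ t in (0 : ℝ)..T, z t ≤ M * ρ / ω + M * β * ((∫ s, g s) * (1 / ω)) := by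
    set k : ℝ → ℝ := (Iio 0).indicator fun u ↦ Real.exp (ω * u) with hk
    have hki : Integrable k := (integrable_indicator_iff measurableSet_Iio).2
      ((integrableOn_exp_mul_Iic hω 0).mono_set Iio_subset_Iic_self)
    have hk0 : 0 ≤ k := indicator_nonneg fun u _ ↦ (Real.exp_pos _).le
    have hkint : ∫ u, k u = 1 / ω := by
      rw [hk, integral_indicator measurableSet_Iio, ← integral_Iic_eq_integral_Iio,
        integral_exp_mul_Iic hω]
      simp
    have h := intervalIntegral_le_of_le_add_mul_convolution hT.le hMβ hz
      (b := fun t ↦ M * ρ * Real.exp (-ω * (T - t))) (by fun_prop) hgi hki hg0 hk0 fun t ht ↦ by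
        rw [integral_indicator_Ioc_mul_indicator_Iio ht]
        refine (hzineq t ht).trans_eq ?_
        simp only [hf, show ∀ s, -ω * (s - t) = ω * (t - s) from fun s ↦ by ring]
    rw [intervalIntegral.integral_const_mul, hkint,
      intervalIntegral.integral_comp_sub_left (fun t ↦ Real.exp (-ω * t)), sub_self, sub_zero] at h
    have := mul_le_mul_of_nonneg_left (intervalIntegral_exp_neg_mul_le hω hT.le)
      (mul_nonneg (by linarith : 0 ≤ M) hρ)
    rw [mul_one_div] at this
    linarith
  have hsum : ∫ s in (0 : ℝ)..T, f s = (∫ s in (0 : ℝ)..T, y s) + ∫ s in (0 : ℝ)..T, z s :=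
    intervalIntegral.integral_add (hy.intervalIntegrable_of_Icc hT.le)
      (hz.intervalIntegrable_of_Icc hT.le)
  have hI := mul_le_mul_of_nonneg_right hsmall (integral_nonneg hg0 : 0 ≤ ∫ s, g s)
  have e₁ : 2 * M / γ * y 0 = 2 * (M * y 0 / γ) := by ring
  have e₂ : 2 * M / ω * ρ = 2 * (M * ρ / ω) := by ring
  linarith
end

section
/- Let a > 0 and κ ≥ 0 with a > 2κ, set b₁ := √(a² − 2aκ), and let C₀ ≥ 0. If f : [0,∞) → [0,∞) is continuous, bounded, and satisfies f(t) ≤ C₀·e^{−at} + κ·∫₀^∞ e^{−a|t−s|} f(s) ds for all t ≥ 0, then there exists a constant C ≥ 0 such that f(t) ≤ C·e^{−b₁ t} for all t ≥ 0. -/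
open MeasureTheory Set Real in
/-- The two-sided exponential convolution of a decaying exponential on the half-line. -/
lemma integrableOn_and_integral_exp_neg_abs_mul_exp {a b t : ℝ} (hb : 0 ≤ b) (hba : b < a)
    (ht : 0 ≤ t) :
    IntegrableOn (fun s => exp (-a * |t - s|) * exp (-b * s)) (Ioi 0) ∧
      ∫ s in Ioi (0:ℝ), exp (-a * |t - s|) * exp (-b * s) =
        2 * a / (a ^ 2 - b ^ 2) * exp (-b * t) - exp (-a * t) / (a - b) := by
  have h₁ : (a - b) ≠ 0 := by linarith
  have h₂ : (a + b) ≠ 0 := by linarith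
  have e₁ : EqOn (fun s => exp (-a * t) * exp ((a - b) * s))
      (fun s => exp (-a * |t - s|) * exp (-b * s)) (Ioc 0 t) := by
    intro s hs
    simp only [← exp_add, abs_of_nonneg (sub_nonneg.2 hs.2)]
    ring_nf
  have e₂ : EqOn (fun s => exp (a * t) * exp (-(a + b) * s))
      (fun s => exp (-a * |t - s|) * exp (-b * s)) (Ioi t) := by
    intro s hs
    simp only [← exp_add, abs_of_neg (sub_neg.2 (mem_Ioi.1 hs))]
    ring_nf
  have i₁ : IntegrableOn (fun s => exp (-a * |t - s|) * exp (-b * s)) (Ioc 0 t) :=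
    (Continuous.integrableOn_Ioc (by fun_prop)).congr_fun e₁ measurableSet_Ioc
  have i₂ : IntegrableOn (fun s => exp (-a * |t - s|) * exp (-b * s)) (Ioi t) :=
    IntegrableOn.congr_fun
      ((integrableOn_exp_mul_Ioi (a := -(a + b)) (by linarith) t).const_mul _) e₂ measurableSet_Ioi
  have v₁ : ∫ s in Ioc 0 t, exp ((a - b) * s) = (exp ((a - b) * t) - 1) / (a - b) := by
    rw [← intervalIntegral.integral_of_le ht,
      intervalIntegral.integral_comp_mul_left (fun x => exp x) h₁, integral_exp]
    simp [div_eq_inv_mul]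
  have m₁ : exp (-a * t) * exp ((a - b) * t) = exp (-b * t) := by
    rw [← exp_add]; ring_nf
  have m₂ : exp (a * t) * exp (-(a + b) * t) = exp (-b * t) := by
    rw [← exp_add]; ring_nf
  have hsq : a ^ 2 - b ^ 2 = (a - b) * (a + b) := by ring
  refine ⟨Ioc_union_Ioi_eq_Ioi ht ▸ i₁.union i₂, ?_⟩
  rw [← Ioc_union_Ioi_eq_Ioi ht,
    setIntegral_union (Ioc_disjoint_Ioi le_rfl) measurableSet_Ioi i₁ i₂,
    ← setIntegral_congr_fun measurableSet_Ioc e₁, ← setIntegral_congr_fun measurableSet_Ioi e₂,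
    integral_const_mul, integral_const_mul, v₁, integral_exp_mul_Ioi (by linarith), hsq,
    mul_div_assoc', mul_sub, m₁, mul_div_assoc', mul_neg, m₂]
  field_simp
  ring

/-- Key real-analysis lemma behind the exponential decay (eq:exp-decay-y-z-unstable) in
the proof of Theorem 3.2 of the paper: a bounded nonnegative function dominated by a
decaying exponential plus a small two-sided exponential convolution decays exponentially
with rate `√(a² − 2aκ)`. -/
theorem two_sided_convolution_decay
    (a κ C₀ : ℝ) (ha : 0 < a) (hκ : 0 ≤ κ) (haκ : 2 * κ < a) (hC₀ : 0 ≤ C₀)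
    (b₁ : ℝ) (hb₁ : b₁ = Real.sqrt (a ^ 2 - 2 * a * κ))
    (f : ℝ → ℝ) (hf : ContinuousOn f (Set.Ici 0))
    (hfnn : ∀ t, 0 ≤ t → 0 ≤ f t)
    (hbdd : ∃ B : ℝ, ∀ t, 0 ≤ t → f t ≤ B)
    (hineq : ∀ t, 0 ≤ t →
      f t ≤ C₀ * Real.exp (-a * t) +
        κ * ∫ s in Set.Ioi (0:ℝ), Real.exp (-a * |t - s|) * f s) :
    ∃ C : ℝ, 0 ≤ C ∧ ∀ t, 0 ≤ t → f t ≤ C * Real.exp (-b₁ * t) := by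
  obtain ⟨B, hB⟩ := hbdd
  have hnn : 0 ≤ a ^ 2 - 2 * a * κ := by nlinarith
  have hb0 : 0 ≤ b₁ := hb₁ ▸ Real.sqrt_nonneg _
  have hbsq : b₁ ^ 2 = a ^ 2 - 2 * a * κ := by rw [hb₁, Real.sq_sqrt hnn]
  rcases hκ.eq_or_lt with rfl | hκpos
  · have hba : b₁ = a := by rw [hb₁]; simp [Real.sqrt_sq ha.le]
    exact ⟨C₀, hC₀, fun t ht => by simpa [hba] using hineq t ht⟩
  have hba : b₁ < a := by nlinarith [mul_pos ha hκpos]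
  have hab : 0 < a - b₁ := sub_pos.2 hba
  set C : ℝ := C₀ * (a - b₁) / κ with hC
  have hC0 : 0 ≤ C := by positivity
  have improve : ∀ M : ℝ, 0 ≤ M → (∀ t, 0 ≤ t → f t ≤ C * Real.exp (-b₁ * t) + M) →
      ∀ t, 0 ≤ t → f t ≤ C * Real.exp (-b₁ * t) + 2 * κ / a * M := by
    intro M hM h t ht
    obtain ⟨i₁, v₁⟩ := integrableOn_and_integral_exp_neg_abs_mul_exp hb0 hba ht
    obtain ⟨i₀, v₀⟩ := integrableOn_and_integral_exp_neg_abs_mul_exp le_rfl ha ht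
    have key : ∫ s in Set.Ioi (0:ℝ), Real.exp (-a * |t - s|) * f s ≤
        ∫ s in Set.Ioi (0:ℝ), (C * (Real.exp (-a * |t - s|) * Real.exp (-b₁ * s)) +
          M * (Real.exp (-a * |t - s|) * Real.exp (-0 * s))) := by
      refine MeasureTheory.integral_mono_of_nonneg ?_
        ((i₁.const_mul C).add (i₀.const_mul M)) ?_
      · filter_upwards [MeasureTheory.ae_restrict_mem measurableSet_Ioi] with s hs
        exact mul_nonneg (Real.exp_pos _).le (hfnn s (le_of_lt hs))
      · filter_upwards [MeasureTheory.ae_restrict_mem measurableSet_Ioi] with s hs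
        have := mul_le_mul_of_nonneg_left (h s (le_of_lt hs)) (Real.exp_pos (-a * |t - s|)).le
        simp only [neg_zero, zero_mul, Real.exp_zero]
        linarith
    rw [MeasureTheory.integral_add (i₁.const_mul C) (i₀.const_mul M),
      MeasureTheory.integral_const_mul, MeasureTheory.integral_const_mul, v₁, v₀, hbsq] at key
    have hsolve : C₀ * Real.exp (-a * t) + κ * (C * (2 * a / (a ^ 2 - (a ^ 2 - 2 * a * κ)) *
        Real.exp (-b₁ * t) - Real.exp (-a * t) / (a - b₁))) = C * Real.exp (-b₁ * t) := by
      rw [sub_sub_cancel, hC]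
      field_simp
      ring
    have hmass : κ * (M * (2 * a / (a ^ 2 - 0 ^ 2) * Real.exp (-0 * t) -
        Real.exp (-a * t) / (a - 0))) ≤ 2 * κ / a * M := by
      have : 2 * κ / a * M - κ * (M * (2 * a / (a ^ 2 - 0 ^ 2) * Real.exp (-0 * t) -
          Real.exp (-a * t) / (a - 0))) = κ * M * Real.exp (-a * t) / a := by
        simp only [neg_zero, zero_mul, Real.exp_zero, sub_zero, ne_eq, OfNat.ofNat_ne_zero,
          not_false_eq_true, zero_pow]
        field_simp
        ring
      have : 0 ≤ κ * M * Real.exp (-a * t) / a := by positivity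
      linarith
    have := mul_le_mul_of_nonneg_left key hκ
    linarith [hineq t ht]
  have hq : 2 * κ / a < 1 := (div_lt_one ha).2 haκ
  have iter : ∀ n : ℕ, ∀ t, 0 ≤ t →
      f t ≤ C * Real.exp (-b₁ * t) + (2 * κ / a) ^ n * max B 0 := by
    intro n
    induction n with
    | zero =>
      intro t ht
      have : 0 ≤ C * Real.exp (-b₁ * t) := by positivity
      linarith [hB t ht, le_max_left B 0]
    | succ n ih =>
      intro t ht
      rw [pow_succ', mul_assoc]
      exact improve _ (by positivity) ih t ht
  refine ⟨C, hC0, fun t ht => ?_⟩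
  have lim := ((tendsto_pow_atTop_nhds_zero_of_lt_one (by positivity) hq).mul_const
    (max B 0)).const_add (C * Real.exp (-b₁ * t))
  rw [zero_mul, add_zero] at lim
  exact ge_of_tendsto' lim fun n => iter n t ht
end

section
/- Let a > 0 and let h : [0,∞) → ℝ be continuous and bounded. If g : [0,∞) → ℝ is continuous, bounded, twice differentiable on (0,∞), and satisfies −g″(t) + a²·g(t) = 2a·h(t) for all t > 0, then there exists C ∈ ℝ such that g(t) = C·e^{−at} + ∫₀^∞ e^{−a|t−s|} h(s) ds for all t > 0. -/
open Set Filter Topology MeasureTheory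

/-- Splitting of the two-sided exponential convolution on the half-line at the point `t`. -/
theorem integral_exp_neg_abs_sub_mul {a t : ℝ} (ht : 0 ≤ t) {H : ℝ → ℝ} (hH : Continuous H)
    (hint : IntegrableOn (fun s => Real.exp (-a * s) * H s) (Ioi 0)) :
    ∫ s in Ioi (0 : ℝ), Real.exp (-a * |t - s|) * H s =
      Real.exp (-a * t) * (∫ s in (0 : ℝ)..t, Real.exp (a * s) * H s) +
        Real.exp (a * t) * ((∫ s in Ioi (0 : ℝ), Real.exp (-a * s) * H s) -
          ∫ s in (0 : ℝ)..t, Real.exp (-a * s) * H s) := by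
  have hright : ∀ s ∈ Ioi t, Real.exp (a * t) * (Real.exp (-a * s) * H s) =
      Real.exp (-a * |t - s|) * H s := by
    intro s hs
    rw [abs_of_neg (sub_neg.2 hs), ← mul_assoc, ← Real.exp_add]
    ring_nf
  have hleft : ∀ s ∈ uIcc 0 t, Real.exp (-a * |t - s|) * H s =
      Real.exp (-a * t) * (Real.exp (a * s) * H s) := by
    intro s hs
    rw [uIcc_of_le ht] at hs
    rw [abs_of_nonneg (sub_nonneg.2 hs.2), ← mul_assoc, ← Real.exp_add]
    ring_nf
  have hintt := hint.mono_set (Ioi_subset_Ioi ht)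
  have hconv : IntegrableOn (fun s => Real.exp (-a * |t - s|) * H s) (Ioi t) :=
    (integrableOn_congr_fun hright measurableSet_Ioi).1 (hintt.const_mul _)
  have hcont : Continuous fun s => Real.exp (-a * |t - s|) * H s := by fun_prop
  have hcont' : Continuous fun s => Real.exp (-a * s) * H s := by fun_prop
  rw [← intervalIntegral.integral_interval_add_Ioi' (hcont.intervalIntegrable 0 t) hconv,
    ← intervalIntegral.integral_interval_add_Ioi' (hcont'.intervalIntegrable 0 t) hintt,
    intervalIntegral.integral_congr hleft, intervalIntegral.integral_const_mul,
    add_sub_cancel_left, ← integral_const_mul, setIntegral_congr_fun measurableSet_Ioi hright]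

/-- A function with vanishing derivative on the open half-line is constant there. -/
theorem exists_eq_const_of_hasDerivAt_zero_Ioi {f : ℝ → ℝ}
    (hf : ∀ t, 0 < t → HasDerivAt f 0 t) : ∃ c, ∀ t, 0 < t → f t = c :=
  ⟨f 1, fun _ ht => isOpen_Ioi.is_const_of_deriv_eq_zero isPreconnected_Ioi
    (fun s hs => (hf s hs).differentiableAt.differentiableWithinAt)
    (fun _ hs => (hf _ hs).deriv) ht (mem_Ioi.2 one_pos)⟩

/-- The integral of `exp (a s) H s` over `[0, t]`, with `H` bounded, is `o (exp (2 a t))`. -/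
theorem tendsto_exp_neg_mul_integral_exp_mul {a B : ℝ} (ha : 0 < a) {H : ℝ → ℝ}
    (hB : ∀ s, |H s| ≤ B) :
    Tendsto (fun t => Real.exp (-(2 * a) * t) * ∫ s in (0 : ℝ)..t, Real.exp (a * s) * H s)
      atTop (𝓝 0) := by
  have hlim : Tendsto (fun t : ℝ => B * (t * Real.exp (-a * t))) atTop (𝓝 0) := by
    have := (Real.tendsto_pow_mul_exp_neg_atTop_nhds_zero 1).comp
      (tendsto_id.const_mul_atTop ha)
    have := this.const_mul (B / a)
    rw [mul_zero] at this
    refine this.congr fun t => ?_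
    simp only [Function.comp, id, pow_one, neg_mul]
    field_simp
  refine squeeze_zero_norm' ?_ hlim
  filter_upwards [eventually_ge_atTop 0] with t ht
  have hF : ‖∫ s in (0 : ℝ)..t, Real.exp (a * s) * H s‖ ≤ Real.exp (a * t) * B * |t - 0| := by
    refine intervalIntegral.norm_integral_le_of_norm_le_const fun s hs => ?_
    rw [uIoc_of_le ht] at hs
    rw [norm_mul, Real.norm_eq_abs, Real.norm_eq_abs, Real.abs_exp]
    have : Real.exp (a * s) ≤ Real.exp (a * t) :=
      Real.exp_le_exp.2 (mul_le_mul_of_nonneg_left hs.2 ha.le)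
    exact mul_le_mul this (hB s) (abs_nonneg _) (Real.exp_pos _).le
  rw [norm_mul, Real.norm_of_nonneg (Real.exp_pos _).le]
  calc _ ≤ Real.exp (-(2 * a) * t) * (Real.exp (a * t) * B * |t - 0|) := by gcongr
    _ = B * (t * (Real.exp (-(2 * a) * t) * Real.exp (a * t))) := by
      rw [sub_zero, abs_of_nonneg ht]; ring
    _ = _ := by rw [← Real.exp_add]; ring_nf


/-- Superposition-principle representation of bounded solutions of `−g″ + a² g = 2a h`
on the half-line, used in the proof of Theorem 3.2 of the paper (after (2.82)):
every bounded solution equals a multiple of `e^{-at}` plus the particular solution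
given by the two-sided exponential convolution. -/
theorem bounded_solution_representation
    (a : ℝ) (ha : 0 < a) (h g g' g'' : ℝ → ℝ)
    (hhcont : ContinuousOn h (Set.Ici 0))
    (hhbdd : ∃ B : ℝ, ∀ t, 0 ≤ t → |h t| ≤ B)
    (hgcont : ContinuousOn g (Set.Ici 0))
    (hgbdd : ∃ B : ℝ, ∀ t, 0 ≤ t → |g t| ≤ B)
    (hg' : ∀ t, 0 < t → HasDerivAt g (g' t) t)
    (hg'' : ∀ t, 0 < t → HasDerivAt g' (g'' t) t)
    (hode : ∀ t, 0 < t → -(g'' t) + a ^ 2 * g t = 2 * a * h t) :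
    ∃ C : ℝ, ∀ t, 0 < t →
      g t = C * Real.exp (-a * t) +
        ∫ s in Set.Ioi (0:ℝ), Real.exp (-a * |t - s|) * h s := by
  obtain ⟨Bh, hBh⟩ := hhbdd
  obtain ⟨Bg, hBg⟩ := hgbdd
  obtain ⟨H, hH, hHh, hHB⟩ : ∃ H : ℝ → ℝ, Continuous H ∧ (∀ t, 0 ≤ t → H t = h t) ∧
      ∀ t, |H t| ≤ Bh :=
    ⟨fun t => h (max t 0),
      hhcont.comp_continuous (by fun_prop) fun t => le_max_right t 0,
      fun t ht => by simp [ht], fun t => hBh _ (le_max_right t 0)⟩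
  have hint : IntegrableOn (fun s => Real.exp (-a * s) * H s) (Ioi 0) :=
    (exp_neg_integrableOn_Ioi 0 ha).mul_bdd hH.aestronglyMeasurable
      (Eventually.of_forall hHB)
  have hcontF : Continuous fun s => Real.exp (a * s) * H s := by fun_prop
  have hcontG : Continuous fun s => Real.exp (-a * s) * H s := by fun_prop
  set F : ℝ → ℝ := fun t => ∫ s in (0 : ℝ)..t, Real.exp (a * s) * H s
  set K : ℝ → ℝ := fun t => ∫ s in (0 : ℝ)..t, Real.exp (-a * s) * H s
  set I : ℝ := ∫ s in Ioi (0 : ℝ), Real.exp (-a * s) * H s with hI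
  have hderF (t : ℝ) : HasDerivAt F (Real.exp (a * t) * H t) t :=
    hcontF.integral_hasStrictDerivAt 0 t |>.hasDerivAt
  have hderK (t : ℝ) : HasDerivAt K (Real.exp (-a * t) * H t) t :=
    hcontG.integral_hasStrictDerivAt 0 t |>.hasDerivAt
  have hexp (b t : ℝ) : HasDerivAt (fun t => Real.exp (b * t)) (Real.exp (b * t) * b) t := by
    simpa using ((hasDerivAt_id t).const_mul b).exp
  obtain ⟨c, hc⟩ : ∃ c, ∀ t, 0 < t →
      Real.exp (-a * t) * (g' t + a * g t) - 2 * a * (I - K t) = c := by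
    refine exists_eq_const_of_hasDerivAt_zero_Ioi fun t ht => ?_
    refine (((hexp (-a) t).mul ((hg'' t ht).add ((hg' t ht).const_mul a))).sub
      (((hderK t).const_sub I).const_mul (2 * a))).congr_deriv ?_
    simp only [Pi.add_apply]
    rw [hHh t ht.le]
    linear_combination -Real.exp (-a * t) * hode t ht
  obtain ⟨d, hd⟩ : ∃ d, ∀ t, 0 < t →
      Real.exp (a * t) * (g' t - a * g t) + 2 * a * F t = d := by
    refine exists_eq_const_of_hasDerivAt_zero_Ioi fun t ht => ?_
    refine (((hexp a t).mul ((hg'' t ht).sub ((hg' t ht).const_mul a))).add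
      ((hderF t).const_mul (2 * a))).congr_deriv ?_
    simp only [Pi.sub_apply]
    rw [hHh t ht.le]
    linear_combination -Real.exp (a * t) * hode t ht
  have hinv (t : ℝ) : Real.exp (a * t) * Real.exp (-a * t) = 1 := by
    rw [← Real.exp_add]; simp
  have hc0 : c = 0 := by
    have hdecay {b : ℝ} (hb : 0 < b) : Tendsto (fun t => Real.exp (-b * t)) atTop (𝓝 0) :=
      Real.tendsto_exp_atBot.comp (tendsto_id.const_mul_atTop_of_neg (neg_lt_zero.2 hb))
    have hg0 : Tendsto (fun t => Real.exp (-a * t) * g t) atTop (𝓝 0) := by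
      refine squeeze_zero_norm' ?_ (zero_mul Bg ▸ (hdecay ha).mul_const Bg)
      filter_upwards [eventually_ge_atTop 0] with t ht
      rw [norm_mul, Real.norm_of_nonneg (Real.exp_pos _).le]
      exact mul_le_mul_of_nonneg_left (hBg t ht) (Real.exp_pos _).le
    have hK0 : Tendsto (fun t => I - K t) atTop (𝓝 0) := by
      have := (intervalIntegral_tendsto_integral_Ioi 0 hint tendsto_id).const_sub I
      rwa [← hI, sub_self] at this
    have hlim := (((hg0.const_mul (2 * a)).add
      ((hdecay (mul_pos two_pos ha)).mul_const d)).sub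
      ((tendsto_exp_neg_mul_integral_exp_mul ha hHB).const_mul (2 * a))).sub
      (hK0.const_mul (2 * a))
    simp only [mul_zero, zero_mul, add_zero, sub_zero] at hlim
    refine tendsto_nhds_unique (tendsto_const_nhds.congr' ?_) hlim
    filter_upwards [eventually_gt_atTop 0] with t ht
    have h2 : Real.exp (-(2 * a) * t) = Real.exp (-a * t) * Real.exp (-a * t) := by
      rw [← Real.exp_add]; ring_nf
    rw [h2, ← hc t ht, ← hd t ht]
    linear_combination (-Real.exp (-a * t) * (g' t - a * g t)) * hinv t
  refine ⟨-d / (2 * a), fun t ht => ?_⟩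
  have hconv : ∫ s in Ioi (0 : ℝ), Real.exp (-a * |t - s|) * h s =
      Real.exp (-a * t) * F t + Real.exp (a * t) * (I - K t) := by
    rw [← integral_exp_neg_abs_sub_mul ht.le hH hint]
    exact setIntegral_congr_fun measurableSet_Ioi fun s hs => by
      simp only [hHh s (le_of_lt hs)]
  have hct := hc t ht
  rw [hc0] at hct
  have hq : 2 * a * (-d / (2 * a)) = -d := mul_div_cancel₀ _ (by positivity)
  refine mul_left_cancel₀ (mul_pos two_pos ha).ne' ?_
  rw [hconv]
  linear_combination Real.exp (a * t) * hct - (2 * a * g t) * hinv t -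
    Real.exp (-a * t) * hq - Real.exp (-a * t) * hd t ht
end

section
/- Assume λ₁, λ₂, λ₃ are pairwise distinct. Let ω, γ ∈ ℝ³ with |γ| = 1. Then the pair (ω, γ) satisfies the steady-state equations ω × (I·ω) = β²·(e₃ × γ) and ω × γ = 0 if and only if there exists α ∈ ℝ with ω = α·γ and one of the following holds: (i) γ = e₃ or γ = −e₃; (ii) α ≠ 0, γ₂ = 0 and γ₃ = −β²/(α²(λ₃ − λ₁)); (iii) α ≠ 0, γ₁ = 0 and γ₃ = −β²/(α²(λ₃ − λ₂)). -/
open Matrix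

/-- A vector with vanishing cross product with a unit vector is its orthogonal projection. -/
lemma eq_dotProduct_smul_of_crossProduct_eq_zero {v u : Fin 3 → ℝ}
    (hu : u 0 ^ 2 + u 1 ^ 2 + u 2 ^ 2 = 1) (h : crossProduct v u = 0) :
    v = (v ⬝ᵥ u) • u := by
  have a := congrFun h 0
  have b := congrFun h 1
  have c := congrFun h 2
  simp [cross_apply] at a b c
  ext i
  fin_cases i <;> simp [dotProduct, Fin.sum_univ_three]
  · linear_combination -v 0 * hu + u 1 * c - u 2 * b
  · linear_combination -v 1 * hu + u 2 * a - u 0 * c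
  · linear_combination -v 2 * hu + u 0 * b - u 1 * a

/-- A unit vector with vanishing first two coordinates is `±e₃`. -/
lemma eq_or_eq_neg_of_horizontal_eq_zero {u : Fin 3 → ℝ}
    (hu : u 0 ^ 2 + u 1 ^ 2 + u 2 ^ 2 = 1) (h0 : u 0 = 0) (h1 : u 1 = 0) :
    u = ![0, 0, 1] ∨ u = -![0, 0, 1] := by
  have h : u 2 = 1 ∨ u 2 = -1 := by simpa [h0, h1] using hu
  rcases h with h | h
  · left; ext i; fin_cases i <;> simp [h0, h1, h]
  · right; ext i; fin_cases i <;> simp [h0, h1, h]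

/-- The steady-state balance of torques for a rotation about the vertical, in coordinates. -/
lemma crossProduct_smul_inertia_eq_iff (l₁ l₂ l₃ b a : ℝ) (u : Fin 3 → ℝ) :
    crossProduct (a • u) ![l₁ * (a • u) 0, l₂ * (a • u) 1, l₃ * (a • u) 2] =
        b • crossProduct ![0, 0, 1] u ↔
      u 1 * (a ^ 2 * (l₃ - l₂) * u 2 + b) = 0 ∧
      u 0 * (a ^ 2 * (l₃ - l₁) * u 2 + b) = 0 ∧
      a ^ 2 * (l₂ - l₁) * (u 0 * u 1) = 0 := by
  simp only [funext_iff, Fin.forall_fin_succ, cross_apply]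
  simp [-mul_eq_zero]
  refine and_congr ?_ (and_congr ?_ ?_) <;> constructor <;> intro h
  · linear_combination h
  · linear_combination h
  · linear_combination -h
  · linear_combination -h
  · linear_combination h
  · linear_combination h

/-- Theorem 4.2, case (5), of the paper (finite-dimensional content): for pairwise
distinct moments of inertia, the steady states of the fluid-filled heavy solid are
exactly the permanent rotations `PR` together with the two families `SP₁` and `SP₂`. -/
theorem steady_states_characterization
    (lam₁ lam₂ lam₃ β : ℝ)
    (h1 : 0 < lam₁) (h2 : 0 < lam₂) (h3 : 0 < lam₃) (hβ : 0 < β)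
    (h12 : lam₁ ≠ lam₂) (h13 : lam₁ ≠ lam₃) (h23 : lam₂ ≠ lam₃)
    (Iv : (Fin 3 → ℝ) → (Fin 3 → ℝ))
    (hIv : Iv = fun v => ![lam₁ * v 0, lam₂ * v 1, lam₃ * v 2])
    (ω γ : Fin 3 → ℝ) (hγ : γ 0 ^ 2 + γ 1 ^ 2 + γ 2 ^ 2 = 1) :
    (crossProduct ω (Iv ω) = β ^ 2 • crossProduct ![0, 0, 1] γ ∧
      crossProduct ω γ = 0) ↔
    ∃ α : ℝ, ω = α • γ ∧
      ((γ = ![0, 0, 1] ∨ γ = -![0, 0, 1]) ∨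
        (α ≠ 0 ∧ γ 1 = 0 ∧ γ 2 = -β ^ 2 / (α ^ 2 * (lam₃ - lam₁))) ∨
        (α ≠ 0 ∧ γ 0 = 0 ∧ γ 2 = -β ^ 2 / (α ^ 2 * (lam₃ - lam₂)))) := by
  subst hIv
  constructor
  · rintro ⟨h, hc⟩
    obtain ⟨α, rfl⟩ : ∃ α : ℝ, ω = α • γ :=
      ⟨_, eq_dotProduct_smul_of_crossProduct_eq_zero hγ hc⟩
    obtain ⟨e1, e0, e2⟩ := (crossProduct_smul_inertia_eq_iff _ _ _ _ _ _).mp h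
    refine ⟨α, rfl, ?_⟩
    by_cases hh : γ 0 = 0 ∧ γ 1 = 0
    · exact Or.inl (eq_or_eq_neg_of_horizontal_eq_zero hγ hh.1 hh.2)
    have hα : α ≠ 0 := by
      rintro rfl
      exact hh ⟨by simpa [hβ.ne'] using e0, by simpa [hβ.ne'] using e1⟩
    have h01 : γ 0 * γ 1 = 0 :=
      (mul_eq_zero.mp e2).resolve_left (mul_ne_zero (pow_ne_zero 2 hα) (sub_ne_zero.mpr h12.symm))
    right
    rcases mul_eq_zero.mp h01 with h0 | h1
    · refine Or.inr ⟨hα, h0, ?_⟩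
      rw [eq_div_iff (mul_ne_zero (pow_ne_zero 2 hα) (sub_ne_zero.mpr h23.symm))]
      linear_combination (mul_eq_zero.mp e1).resolve_left fun h1 => hh ⟨h0, h1⟩
    · refine Or.inl ⟨hα, h1, ?_⟩
      rw [eq_div_iff (mul_ne_zero (pow_ne_zero 2 hα) (sub_ne_zero.mpr h13.symm))]
      linear_combination (mul_eq_zero.mp e0).resolve_left fun h0 => hh ⟨h0, h1⟩
  · rintro ⟨α, rfl, h⟩
    refine ⟨(crossProduct_smul_inertia_eq_iff _ _ _ _ _ _).mpr ?_, by simp⟩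
    rcases h with (rfl | rfl) | ⟨hα, h1, h⟩ | ⟨hα, h0, h⟩
    · simp
    · simp
    · rw [eq_div_iff (mul_ne_zero (pow_ne_zero 2 hα) (sub_ne_zero.mpr h13.symm))] at h
      refine ⟨by simp [h1], ?_, by simp [h1]⟩
      linear_combination γ 0 * h
    · rw [eq_div_iff (mul_ne_zero (pow_ne_zero 2 hα) (sub_ne_zero.mpr h23.symm))] at h
      refine ⟨?_, by simp [h0], by simp [h0]⟩
      linear_combination γ 1 * h
end

section
/- Let λ₁ ≠ λ₃ and λ₁ ≠ λ₂, let α ∈ ℝ ∖ {0}, and let q = (q₁, 0, q₃) ∈ ℝ³ with q₁ ≠ 0, q₁² + q₃² = 1 and q₃ = −β²/(α²(λ₃ − λ₁)). Then the set K := { (ω, z) ∈ ℝ³ × ℝ³ : α·(q × (I·ω)) + α·(ω × (I·q)) = β²·(e₃ × z) and (ω − α·z) × q = 0 } is a linear subspace of ℝ³ × ℝ³ of dimension 2; explicitly, K is the span of the two linearly independent pairs ((α, 0, 0), (1, 0, 0)) and ((q₁, 0, −q₃), (0, 0, −2q₃/α)). -/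
open Matrix

/-- Finite-dimensional core of Proposition 4.4 of the paper: the kernel of the
linearization around an `SP₁` steady state is identified with the solution set of the
algebraic system (eq:omega-z-1)–(eq:omega-z-2) in `(ω, z)`, which is a two-dimensional
subspace with the stated spanning vectors (eq:N(L)-spanned). -/
theorem kernel_of_linearization_sp1
    (lam₁ lam₂ lam₃ β α q₁ q₃ : ℝ)
    (h1 : 0 < lam₁) (h2 : 0 < lam₂) (h3 : 0 < lam₃) (hβ : 0 < β)
    (h13 : lam₁ ≠ lam₃) (h12 : lam₁ ≠ lam₂) (hα : α ≠ 0) (hq₁ : q₁ ≠ 0)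
    (hnorm : q₁ ^ 2 + q₃ ^ 2 = 1)
    (hq₃ : q₃ = -β ^ 2 / (α ^ 2 * (lam₃ - lam₁)))
    (Iv : (Fin 3 → ℝ) → (Fin 3 → ℝ))
    (hIv : Iv = fun v => ![lam₁ * v 0, lam₂ * v 1, lam₃ * v 2])
    (q : Fin 3 → ℝ) (hq : q = ![q₁, 0, q₃])
    (K : Set ((Fin 3 → ℝ) × (Fin 3 → ℝ)))
    (hK : K = {p : (Fin 3 → ℝ) × (Fin 3 → ℝ) |
      α • crossProduct q (Iv p.1) + α • crossProduct p.1 (Iv q)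
        = β ^ 2 • crossProduct ![0, 0, 1] p.2 ∧
      crossProduct (p.1 - α • p.2) q = 0})
    (v₁ v₂ : (Fin 3 → ℝ) × (Fin 3 → ℝ))
    (hv₁ : v₁ = (![α, 0, 0], ![1, 0, 0]))
    (hv₂ : v₂ = (![q₁, 0, -q₃], ![0, 0, -2 * q₃ / α])) :
    K = ↑(Submodule.span ℝ {v₁, v₂}) ∧
    LinearIndependent ℝ ![v₁, v₂] ∧
    Module.finrank ℝ ↥(Submodule.span ℝ {v₁, v₂}) = 2 := by
  have hd : lam₃ - lam₁ ≠ 0 := sub_ne_zero.mpr h13.symm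
  have hβq : β ^ 2 = α ^ 2 * q₃ * (lam₁ - lam₃) := by
    rw [hq₃]
    field_simp
    ring
  have hli : LinearIndependent ℝ ![v₁, v₂] := by
    rw [LinearIndependent.pair_iff]
    intro s t hst
    have e₁ : s = 0 := by
      have h := congrFun (congrArg Prod.snd hst) 0
      simpa [hv₁, hv₂] using h
    have e₂ : t = 0 := by
      have h := congrFun (congrArg Prod.fst hst) 0
      simpa [hv₁, hv₂, e₁, hq₁] using h
    exact ⟨e₁, e₂⟩
  refine ⟨?_, hli, ?_⟩
  · ext ⟨w, z⟩
    simp only [hK, Set.mem_ofPred_eq, SetLike.mem_coe, Submodule.mem_span_pair]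
    constructor
    · rintro ⟨hE, hC⟩
      have hE₁ := congrFun hE 1
      have hE₂ := congrFun hE 2
      have hC₁ := congrFun hC 1
      have hC₂ := congrFun hC 2
      simp [hIv, hq, cross_apply] at hE₁ hE₂ hC₁ hC₂
      have hw₁ : w 1 = 0 := by
        have h : α * q₁ * (lam₁ - lam₂) * w 1 = 0 := by linear_combination -hE₂
        simpa [hα, hq₁, sub_ne_zero.mpr h12] using h
      have hz₁ : z 1 = 0 := by
        have h : α * q₁ * z 1 = 0 := by
          linear_combination q₁ * hw₁ + hC₂
        simpa [hα, hq₁] using h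
      have hA : q₃ * w 0 + q₁ * w 2 = α * q₃ * z 0 := by
        have h : α * (lam₃ - lam₁) * (q₃ * w 0 + q₁ * w 2 - α * q₃ * z 0) = 0 := by
          linear_combination -hE₁ - z 0 * hβq
        have h' := (mul_eq_zero.mp h).resolve_left (mul_ne_zero hα hd)
        linear_combination h'
      refine ⟨z 0, (w 0 - α * z 0) / q₁, ?_⟩
      rw [hv₁, hv₂]
      refine Prod.ext ?_ ?_ <;> funext i <;> fin_cases i <;> simp
      · field_simp
        ring
      · exact hw₁.symm
      · field_simp
        linear_combination -hA
      · exact hz₁.symm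
      · field_simp
        linear_combination -hA + hC₁
    · rintro ⟨s, t, hst⟩
      obtain ⟨rfl, rfl⟩ := Prod.mk.inj hst
      constructor <;> funext i <;> fin_cases i <;>
        simp [hIv, hq, hv₁, hv₂, cross_apply]
      · linear_combination -s * hβq
      · field_simp
        ring
  · have h := finrank_span_eq_card hli
    rwa [Matrix.range_cons_cons_empty, Fintype.card_fin] at h
end

section
/- Let λ₁ ≠ λ₃ and λ₁ ≠ λ₂, let α ∈ ℝ ∖ {0}, and let q = (q₁, 0, q₃) ∈ ℝ³ with q₁ ≠ 0, q₁² + q₃² = 1 and q₃ = −β²/(α²(λ₃ − λ₁)). Assume moreover that 3β⁴ ≠ α⁴·λ₁·(λ₃ − λ₁). If (ω₀, z₀) ∈ ℝ³ × ℝ³ satisfies α·(q × (I·ω₀)) + α·(ω₀ × (I·q)) = β²·(e₃ × z₀), (ω₀ − α·z₀) × q = 0, z₀ · q = 0, and β²·(z₀ · e₃) = α·(q · (I·ω₀)), then ω₀ = 0 and z₀ = 0. -/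
open Matrix

/-- Finite-dimensional core of Proposition 4.5 of the paper (semi-simplicity of the
eigenvalue `0` of the linearization around an `SP₁` steady state): an element of the
kernel that also lies in the range must satisfy the two additional scalar constraints,
and under the non-degeneracy condition `3β⁴ ≠ α⁴λ₁(λ₃−λ₁)` it vanishes. -/
theorem kernel_range_trivial_intersection_sp1
    (lam₁ lam₂ lam₃ β α q₁ q₃ : ℝ)
    (h1 : 0 < lam₁) (h2 : 0 < lam₂) (h3 : 0 < lam₃) (hβ : 0 < β)
    (h13 : lam₁ ≠ lam₃) (h12 : lam₁ ≠ lam₂) (hα : α ≠ 0) (hq₁ : q₁ ≠ 0)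
    (hnorm : q₁ ^ 2 + q₃ ^ 2 = 1)
    (hq₃ : q₃ = -β ^ 2 / (α ^ 2 * (lam₃ - lam₁)))
    (hnd : 3 * β ^ 4 ≠ α ^ 4 * lam₁ * (lam₃ - lam₁))
    (Iv : (Fin 3 → ℝ) → (Fin 3 → ℝ))
    (hIv : Iv = fun v => ![lam₁ * v 0, lam₂ * v 1, lam₃ * v 2])
    (q : Fin 3 → ℝ) (hq : q = ![q₁, 0, q₃])
    (ω₀ z₀ : Fin 3 → ℝ)
    (heq1 : α • crossProduct q (Iv ω₀) + α • crossProduct ω₀ (Iv q)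
      = β ^ 2 • crossProduct ![0, 0, 1] z₀)
    (heq2 : crossProduct (ω₀ - α • z₀) q = 0)
    (hz₀q : z₀ ⬝ᵥ q = 0)
    (hz₀e₃ : β ^ 2 * (z₀ ⬝ᵥ ![0, 0, 1]) = α * (q ⬝ᵥ Iv ω₀)) :
    ω₀ = 0 ∧ z₀ = 0 := by
  subst hIv hq
  have hd : lam₃ - lam₁ ≠ 0 := sub_ne_zero.2 h13.symm
  have hq₃' : α ^ 2 * (lam₃ - lam₁) * q₃ = -β ^ 2 := by
    rw [hq₃]; field_simp
  have hq₃0 : q₃ ≠ 0 := by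
    rintro rfl
    have := pow_pos hβ 2
    linarith
  have e1 := congrFun heq1 1
  have e2 := congrFun heq1 2
  have f0 := congrFun heq2 0
  have f1 := congrFun heq2 1
  simp [cross_apply] at e1 e2 f0 f1
  simp [dotProduct, Fin.sum_univ_three] at hz₀q hz₀e₃
  generalize ha : ω₀ 0 = a at *
  generalize hb : ω₀ 1 = b at *
  generalize hc : ω₀ 2 = c at *
  generalize hx : z₀ 0 = x at *
  generalize hy : z₀ 1 = y at *
  generalize hw : z₀ 2 = w at *
  have hb0 : b = 0 := by
    have h : (α * q₁ * (lam₂ - lam₁)) * b = 0 := by linear_combination e2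
    exact (mul_eq_zero.1 h).resolve_left
      (mul_ne_zero (mul_ne_zero hα hq₁) (sub_ne_zero.2 h12.symm))
  have hy0 : y = 0 := by
    have h : (α * q₃) * y = 0 := by
      linear_combination -f0 + q₃ * hb0
    exact (mul_eq_zero.1 h).resolve_left (mul_ne_zero hα hq₃0)
  -- `ω₀ - α z₀ = k q`
  obtain ⟨k, hk⟩ : ∃ k, k = a * q₁ + c * q₃ := ⟨_, rfl⟩
  have hak : a = α * x + k * q₁ := by
    linear_combination (-q₁) * hk - α * q₁ * hz₀q - (a - α * x) * hnorm - q₃ * f1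
  have hck : c = α * w + k * q₃ := by
    linear_combination (-q₃) * hk - α * q₃ * hz₀q - (c - α * w) * hnorm + q₁ * f1
  have hwk : α * w = -2 * k * q₃ := by
    have h : (α * (lam₃ - lam₁) * q₁) * (α * w + 2 * k * q₃) = 0 := by
      rw [hak, hck] at e1
      linear_combination -e1 - x * hq₃'
    have := (mul_eq_zero.1 h).resolve_left (mul_ne_zero (mul_ne_zero hα hd) hq₁)
    linarith
  have hk0 : k = 0 := by
    have h1' : 2 * β ^ 2 * w = α * k * (lam₁ + (lam₃ - lam₁) * q₃ ^ 2) := by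
      rw [hak, hck] at hz₀e₃
      linear_combination hz₀e₃ + α ^ 2 * lam₁ * hz₀q + w * hq₃' + α * k * lam₁ * hnorm
    have h2' : k * (-4 * β ^ 2 * q₃ - α ^ 2 * (lam₁ + (lam₃ - lam₁) * q₃ ^ 2)) = 0 := by
      linear_combination α * h1' - 2 * β ^ 2 * hwk
    have h : (3 * β ^ 4 - α ^ 4 * lam₁ * (lam₃ - lam₁)) * k = 0 := by
      linear_combination α ^ 2 * (lam₃ - lam₁) * h2'
        + k * (3 * β ^ 2 + α ^ 2 * (lam₃ - lam₁) * q₃) * hq₃'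
    exact (mul_eq_zero.1 h).resolve_left (sub_ne_zero.2 hnd)
  subst hk0
  have hw0 : w = 0 := by
    have h : α * w = 0 := by linarith
    exact (mul_eq_zero.1 h).resolve_left hα
  have hx0 : x = 0 := by
    have h : x * q₁ = 0 := by rw [hw0] at hz₀q; linarith
    exact (mul_eq_zero.1 h).resolve_right hq₁
  have ha0 : a = 0 := by simpa [hx0] using hak
  have hc0 : c = 0 := by simpa [hw0] using hck
  constructor <;> ext i <;> fin_cases i <;>
    simp [ha, hb, hc, hx, hy, hw, ha0, hb0, hc0, hx0, hy0, hw0]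
end
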